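/- arXiv:2504.07391 — 2 statements merged into one kernel-verified Lean document; each statement's English description precedes it below -/
import Mathlib

section
/- Let T > 0, 0 < α < 1, 0 < β ≤ 1 with β > α, and let u ∈ C^{0,β}([0,T]). Fix N ∈ ℕ, τ = T/N, t_j = jτ, and let n be an integer with 2 ≤ n ≤ N. Then the L2 scheme satisfies |D_t^α u(t_n) − δ_τ^α u(t_n)| ≤ (α/Γ(1−α)) · ( (2^{β+1}+4)(1 − n^{−α})/α + (2^{β−1}+2)/(1−α) + 1/(β−α) ) · [u]_{C^{0,β}[0,T]} · τ^{β−α}. -/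
open Set MeasureTheory

/-- `M` is a Hölder bound (with exponent `β`) for `u` on `[0, T]`, i.e.
`[u]_{C^{0,β}[0,T]} ≤ M`; used with the least such `M`, it encodes the Hölder seminorm. -/
def holderBnd (T β M : ℝ) (u : ℝ → ℝ) : Prop :=
  ∀ x ∈ Set.Icc (0:ℝ) T, ∀ y ∈ Set.Icc (0:ℝ) T, |u x - u y| ≤ M * |x - y| ^ β

/-- The quadratic Lagrange interpolant `Π_{2,j} u` of `u` at the nodes
`t_{j-1} = (j-1)τ`, `t_j = jτ`, `t_{j+1} = (j+1)τ`. -/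
noncomputable def Pi2 (τ : ℝ) (u : ℝ → ℝ) (j : ℕ) (s : ℝ) : ℝ :=
  (s - (j:ℝ)*τ) * (s - ((j:ℝ)+1)*τ) / (2*τ^2) * u (((j:ℝ)-1)*τ)
  - (s - ((j:ℝ)-1)*τ) * (s - ((j:ℝ)+1)*τ) / τ^2 * u ((j:ℝ)*τ)
  + (s - ((j:ℝ)-1)*τ) * (s - (j:ℝ)*τ) / (2*τ^2) * u (((j:ℝ)+1)*τ)

/-- The Caputo fractional derivative of order `α` in integrated form:
`D_t^α u(t) = (1/Γ(1-α)) (u(t)-u(0))/t^α + (α/Γ(1-α)) ∫_0^t (u(t)-u(s))/(t-s)^{α+1} ds`. -/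
noncomputable def caputo (α : ℝ) (u : ℝ → ℝ) (t : ℝ) : ℝ :=
  (1 / Real.Gamma (1 - α)) * (u t - u 0) / t ^ α
    + (α / Real.Gamma (1 - α)) * ∫ s in (0:ℝ)..t, (u t - u s) / (t - s) ^ (α + 1)

/-- The piecewise interpolant `P^n u` of the L2 scheme: it equals `Π_{2,j} u` on
`(t_{j-1}, t_j)` for `1 ≤ j ≤ n-1` and `Π_{2,n-1} u` on `(t_{n-1}, t_n)`.
(For `s ∈ (t_{j-1}, t_j)` one has `⌈s/τ⌉ = j`.) -/
noncomputable def L2interp (τ : ℝ) (u : ℝ → ℝ) (n : ℕ) (s : ℝ) : ℝ :=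
  if ((n:ℝ)-1)*τ < s then Pi2 τ u (n-1) s else Pi2 τ u ⌈s/τ⌉₊ s

/-- The L2 approximation `δ_τ^α u(t_n) = D_t^α (P^n u)(t_n)` of the Caputo derivative. -/
noncomputable def L2approx (α τ : ℝ) (u : ℝ → ℝ) (n : ℕ) : ℝ :=
  caputo α (L2interp τ u n) ((n:ℝ)*τ)


lemma aux_holder {T β M : ℝ} {u : ℝ → ℝ} (hM0 : 0 ≤ M) (hβ : 0 ≤ β) (hM : holderBnd T β M u)
    {x y d : ℝ} (hx : x ∈ Set.Icc (0:ℝ) T) (hy : y ∈ Set.Icc (0:ℝ) T) (h : |x - y| ≤ d) :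
    |u x - u y| ≤ M * d ^ β :=
  (hM x hx y hy).trans
    (mul_le_mul_of_nonneg_left (Real.rpow_le_rpow (abs_nonneg _) h hβ) hM0)

lemma aux_comb {A B C a b c v p q r : ℝ} (hs : A + B + C = 1) (ha : |a - v| ≤ p)
    (hb : |b - v| ≤ q) (hc : |c - v| ≤ r) :
    |A * a + B * b + C * c - v| ≤ |A| * p + |B| * q + |C| * r := by
  have : A * a + B * b + C * c - v = A * (a - v) + B * (b - v) + C * (c - v) := by
    linear_combination v * hs
  rw [this]
  refine (abs_add_three _ _ _).trans ?_
  rw [abs_mul, abs_mul, abs_mul]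
  gcongr

lemma aux_pi2 {τ : ℝ} (hτ : 0 < τ) (u : ℝ → ℝ) (j : ℕ) (θ : ℝ) :
    Pi2 τ u j (((j:ℝ) + θ) * τ) = (θ * (θ - 1) / 2) * u (((j:ℝ)-1)*τ)
      + ((1 + θ) * (1 - θ)) * u ((j:ℝ)*τ) + (θ * (1 + θ) / 2) * u (((j:ℝ)+1)*τ) := by
  unfold Pi2
  field_simp
  ring

/-- bound on the inner intervals -/
lemma aux_inner {T β M τ : ℝ} {u : ℝ → ℝ} (hM0 : 0 ≤ M) (hβ : 0 ≤ β) (hM : holderBnd T β M u)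
    (hτ : 0 < τ) (j : ℕ) (hj : 1 ≤ j) (hjT : ((j:ℝ) + 1) * τ ≤ T) (s : ℝ)
    (h1 : ((j:ℝ) - 1) * τ ≤ s) (h2 : s ≤ j * τ) :
    |Pi2 τ u j s - u s| ≤ (2 ^ (β + 1) + 4) * (M * τ ^ β) := by
  obtain ⟨θ, rfl⟩ : ∃ θ : ℝ, s = ((j:ℝ) + θ) * τ := ⟨s / τ - j, by field_simp; ring⟩
  have hj' : (1:ℝ) ≤ j := by exact_mod_cast hj
  have t1 : -1 ≤ θ := by
    have := le_of_mul_le_mul_right h1 hτ; linarith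
  have t2 : θ ≤ 0 := by
    have := le_of_mul_le_mul_right h2 hτ; linarith
  have hs : ((j:ℝ) + θ) * τ ∈ Set.Icc (0:ℝ) T := ⟨by nlinarith, by nlinarith⟩
  have m0 : ((j:ℝ) - 1) * τ ∈ Set.Icc (0:ℝ) T := ⟨by nlinarith, by nlinarith⟩
  have m1 : (j:ℝ) * τ ∈ Set.Icc (0:ℝ) T := ⟨by nlinarith, by nlinarith⟩
  have m2 : ((j:ℝ) + 1) * τ ∈ Set.Icc (0:ℝ) T := ⟨by nlinarith, by nlinarith⟩
  have e0 := aux_holder hM0 hβ hM m0 hs (d := τ) (by rw [abs_le]; constructor <;> nlinarith)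
  have e1 := aux_holder hM0 hβ hM m1 hs (d := τ) (by rw [abs_le]; constructor <;> nlinarith)
  have e2 := aux_holder hM0 hβ hM m2 hs (d := 2 * τ) (by rw [abs_le]; constructor <;> nlinarith)
  rw [Real.mul_rpow (by norm_num) hτ.le] at e2
  rw [aux_pi2 hτ]
  refine (aux_comb (by ring) e0 e1 e2).trans ?_
  have D0 : 0 ≤ M * τ ^ β := by positivity
  have P0 : (0:ℝ) < 2 ^ β := by positivity
  have a0 : |θ * (θ - 1) / 2| ≤ 1 := by rw [abs_le]; constructor <;> nlinarith
  have a1 : |(1 + θ) * (1 - θ)| ≤ 1 := by rw [abs_le]; constructor <;> nlinarith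
  have a2 : |θ * (1 + θ) / 2| ≤ 1 := by rw [abs_le]; constructor <;> nlinarith
  rw [Real.rpow_add (by norm_num), Real.rpow_one]
  have := mul_le_mul_of_nonneg_right a0 D0
  have := mul_le_mul_of_nonneg_right a1 D0
  have := mul_le_mul_of_nonneg_right a2 (mul_nonneg P0.le D0)
  have := mul_nonneg P0.le D0
  nlinarith

/-- bound on the last interval -/
lemma aux_last {T β M τ : ℝ} {u : ℝ → ℝ} (hM0 : 0 ≤ M) (hβ : 0 ≤ β) (hM : holderBnd T β M u)
    (hτ : 0 < τ) (j : ℕ) (hj : 1 ≤ j) (hjT : ((j:ℝ) + 1) * τ ≤ T) (s : ℝ)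
    (h1 : (j:ℝ) * τ ≤ s) (h2 : s ≤ ((j:ℝ) + 1) * τ) :
    |Pi2 τ u j s - u s| ≤ (2 ^ (β - 1) + 2) * M * τ ^ (β - 1) * (((j:ℝ) + 1) * τ - s)
      + M * (((j:ℝ) + 1) * τ - s) ^ β := by
  obtain ⟨θ, rfl⟩ : ∃ θ : ℝ, s = ((j:ℝ) + θ) * τ := ⟨s / τ - j, by field_simp; ring⟩
  have hj' : (1:ℝ) ≤ j := by exact_mod_cast hj
  have t1 : 0 ≤ θ := by
    have := le_of_mul_le_mul_right h1 hτ; linarith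
  have t2 : θ ≤ 1 := by
    have := le_of_mul_le_mul_right h2 hτ; linarith
  have hs : ((j:ℝ) + θ) * τ ∈ Set.Icc (0:ℝ) T := ⟨by nlinarith, by nlinarith⟩
  have m0 : ((j:ℝ) - 1) * τ ∈ Set.Icc (0:ℝ) T := ⟨by nlinarith, by nlinarith⟩
  have m1 : (j:ℝ) * τ ∈ Set.Icc (0:ℝ) T := ⟨by nlinarith, by nlinarith⟩
  have m2 : ((j:ℝ) + 1) * τ ∈ Set.Icc (0:ℝ) T := ⟨by nlinarith, by nlinarith⟩
  have e0 := aux_holder hM0 hβ hM m0 hs (d := 2 * τ) (by rw [abs_le]; constructor <;> nlinarith)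
  have e1 := aux_holder hM0 hβ hM m1 hs (d := τ) (by rw [abs_le]; constructor <;> nlinarith)
  have e2 := aux_holder hM0 hβ hM m2 hs (d := ((j:ℝ) + 1) * τ - ((j:ℝ) + θ) * τ)
    (by rw [abs_of_nonneg (by linarith)])
  have E0 : 0 ≤ (((j:ℝ) + 1) * τ - ((j:ℝ) + θ) * τ) ^ β := Real.rpow_nonneg (by linarith) _
  rw [Real.mul_rpow (by norm_num) hτ.le] at e0
  rw [aux_pi2 hτ]
  refine (aux_comb (by ring) e0 e1 e2).trans ?_
  have D0 : 0 ≤ M * τ ^ β := by positivity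
  have P0 : (0:ℝ) < 2 ^ β := by positivity
  have a0 : |θ * (θ - 1) / 2| ≤ (1 - θ) / 2 := by rw [abs_le]; constructor <;> nlinarith
  have a1 : |(1 + θ) * (1 - θ)| ≤ 2 * (1 - θ) := by rw [abs_le]; constructor <;> nlinarith
  have a2 : |θ * (1 + θ) / 2| ≤ 1 := by rw [abs_le]; constructor <;> nlinarith
  have k0 := mul_le_mul_of_nonneg_right a0 (mul_nonneg P0.le D0)
  have k1 := mul_le_mul_of_nonneg_right a1 D0
  have k2 := mul_le_mul_of_nonneg_right a2 (mul_nonneg hM0 E0)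
  rw [Real.rpow_sub_one (by norm_num), Real.rpow_sub_one hτ.ne']
  have : ((2:ℝ) ^ β / 2 + 2) * M * (τ ^ β / τ) * (((j:ℝ) + 1) * τ - ((j:ℝ) + θ) * τ)
    = (1 - θ) / 2 * (2 ^ β * (M * τ ^ β)) + 2 * (1 - θ) * (M * τ ^ β) := by
    field_simp
    ring
  rw [this]
  linarith

lemma aux_meas (τ : ℝ) (u : ℝ → ℝ) (n : ℕ) : Measurable (L2interp τ u n) := by
  have hc : ∀ j, Measurable (Pi2 τ u j) := by
    intro j
    unfold Pi2
    fun_prop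
  have h2 : Measurable (fun p : ℕ × ℝ => Pi2 τ u p.1 p.2) :=
    measurable_from_prod_countable_right hc
  unfold L2interp
  refine Measurable.ite measurableSet_Ioi (hc _) ?_
  exact h2.comp ((Nat.measurable_ceil.comp (measurable_id.div_const τ)).prodMk measurable_id)

lemma aux_int {t x y r : ℝ} (h : -1 < r ∨ r ≠ -1 ∧ (0:ℝ) ∉ Set.uIcc (t - y) (t - x)) :
    IntervalIntegrable (fun s => (t - s) ^ r) volume x y := by
  have h0 : IntervalIntegrable (fun v : ℝ => v ^ r) volume (t - x) (t - y) := by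
    rcases h with h | h
    · exact intervalIntegral.intervalIntegrable_rpow' h
    · exact intervalIntegral.intervalIntegrable_rpow (Or.inr (by rw [Set.uIcc_comm]; exact h.2))
  have := h0.comp_sub_left t
  simpa using this

lemma aux_val {t x y r : ℝ} (h : -1 < r ∨ r ≠ -1 ∧ (0:ℝ) ∉ Set.uIcc (t - y) (t - x)) :
    ∫ s in x..y, (t - s) ^ r = ((t - x) ^ (r + 1) - (t - y) ^ (r + 1)) / (r + 1) := by
  rw [intervalIntegral.integral_comp_sub_left (fun v : ℝ => v ^ r), integral_rpow h]

theorem stmt6 (T : ℝ) (hT : 0 < T) (α β : ℝ) (hα0 : 0 < α) (hα1 : α < 1)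
    (hαβ : α < β) (hβ1 : β ≤ 1)
    (u : ℝ → ℝ) (hu : ContinuousOn u (Set.Icc 0 T))
    (M : ℝ) (hM0 : 0 ≤ M) (hM : holderBnd T β M u)
    (N : ℕ) (hN : 0 < N) (τ : ℝ) (hτ : τ = T / N)
    (n : ℕ) (hn : 2 ≤ n) (hnN : n ≤ N) :
    |caputo α u ((n:ℝ)*τ) - L2approx α τ u n| ≤
      (α / Real.Gamma (1 - α)) *
        ((2 ^ (β + 1) + 4) * (1 - (n:ℝ) ^ (-α)) / α
          + (2 ^ (β - 1) + 2) / (1 - α) + 1 / (β - α)) * M * τ ^ (β - α) := by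
  have hNr : (0:ℝ) < N := by exact_mod_cast hN
  have τ0 : 0 < τ := by rw [hτ]; positivity
  have hβ : 0 < β := hα0.trans hαβ
  have hn2 : (2:ℝ) ≤ n := by exact_mod_cast hn
  have hnT : (n:ℝ) * τ ≤ T := by
    have h1 : (n:ℝ) ≤ N := by exact_mod_cast hnN
    have h2 : (N:ℝ) * τ = T := by rw [hτ]; field_simp
    rw [← h2]; gcongr
  obtain ⟨m, rfl⟩ : ∃ m, n = m + 1 := ⟨n - 1, by omega⟩
  have hm : 1 ≤ m := by omega
  have hmr : (1:ℝ) ≤ m := by exact_mod_cast hm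
  push_cast at *
  set t : ℝ := ((m:ℝ) + 1) * τ with ht
  set a : ℝ := (m:ℝ) * τ with ha
  set P := L2interp τ u (m + 1) with hP
  have hta : t - a = τ := by rw [ht, ha]; ring
  have ha0 : 0 < a := by positivity
  have hat : a < t := by linarith
  have ht0 : 0 < t := by linarith
  have P0 : P 0 = u 0 := by
    have : ¬ (((m + 1 : ℕ) : ℝ) - 1) * τ < 0 := by push_cast; nlinarith
    simp only [hP, L2interp, if_neg this, Pi2]
    simp
    field_simp
  have Pl : ∀ s, a < s → P s = Pi2 τ u m s := by
    intro s hs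
    have : (((m + 1 : ℕ) : ℝ) - 1) * τ < s := by push_cast; simpa using hs
    simp only [hP, L2interp, if_pos this, Nat.add_sub_cancel]
  have Pt : P t = u t := by
    rw [Pl t hat, ht, aux_pi2 τ0]
    ring
  have bndA : ∀ s ∈ Ioc 0 a, |P s - u s| ≤ (2 ^ (β + 1) + 4) * (M * τ ^ β) := by
    intro s hs
    have h0 : ¬ (((m + 1 : ℕ) : ℝ) - 1) * τ < s := by push_cast; simpa using hs.2
    have e : P s = Pi2 τ u ⌈s / τ⌉₊ s := by simp only [hP, L2interp, if_neg h0]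
    rw [e]
    have hsp : 0 < s / τ := div_pos hs.1 τ0
    have c1 : ⌈s / τ⌉₊ ≤ m := by
      rw [Nat.ceil_le, div_le_iff₀ τ0]; exact hs.2
    have c1r : ((⌈s / τ⌉₊ : ℕ) : ℝ) ≤ m := by exact_mod_cast c1
    have c2 := Nat.ceil_lt_add_one hsp.le
    have c3 := Nat.le_ceil (s / τ)
    refine aux_inner hM0 hβ.le hM τ0 _ (Nat.ceil_pos.2 hsp) ?_ s ?_ ?_
    · refine le_trans ?_ hnT
      rw [ht]; gcongr
    · rw [← le_div_iff₀ τ0]; linarith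
    · rwa [div_le_iff₀ τ0] at c3
  have bndB : ∀ s ∈ Ioc a t, |P s - u s| ≤ (2 ^ (β - 1) + 2) * M * τ ^ (β - 1) * (t - s)
      + M * (t - s) ^ β := by
    intro s hs
    rw [Pl s hs.1]
    exact aux_last hM0 hβ.le hM τ0 m hm hnT s hs.1.le hs.2
  set f : ℝ → ℝ := fun s => (P s - u s) / (t - s) ^ (α + 1) with hf
  set g : ℝ → ℝ := fun s => (u t - u s) / (t - s) ^ (α + 1) with hg
  set A : ℝ := (2 ^ (β + 1) + 4) * (M * τ ^ β) with hA
  set K : ℝ := (2 ^ (β - 1) + 2) * M * τ ^ (β - 1) with hK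
  have hK0 : 0 ≤ K := by positivity
  have umeas : ∀ x y, 0 ≤ x → y ≤ t →
      AEStronglyMeasurable u (volume.restrict (Ioc x y)) := by
    intro x y hx hy
    exact (hu.mono (fun z hz => ⟨hx.trans hz.1.le, hz.2.trans (hy.trans hnT)⟩)).aestronglyMeasurable
      measurableSet_Ioc
  have kmeas : Measurable (fun s : ℝ => (t - s) ^ (α + 1)) := by fun_prop
  have fmeas : ∀ x y, 0 ≤ x → y ≤ t →
      AEStronglyMeasurable f (volume.restrict (Ioc x y)) := by
    intro x y hx hy
    exact (((aux_meas τ u (m+1)).aestronglyMeasurable.sub (umeas x y hx hy)).aemeasurable.div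
      kmeas.aemeasurable).aestronglyMeasurable
  have gmeas : ∀ x y, 0 ≤ x → y ≤ t →
      AEStronglyMeasurable g (volume.restrict (Ioc x y)) := by
    intro x y hx hy
    exact ((aestronglyMeasurable_const.sub (umeas x y hx hy)).aemeasurable.div
      kmeas.aemeasurable).aestronglyMeasurable
  have z1 : (0:ℝ) ∉ Set.uIcc (t - a) (t - 0) := by
    rw [Set.uIcc_of_le (by linarith)]
    intro h; have := h.1; linarith
  have r1 : -1 < -(α+1) ∨ -(α+1) ≠ -1 ∧ (0:ℝ) ∉ Set.uIcc (t - a) (t - 0) :=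
    Or.inr ⟨by intro h; linarith, z1⟩
  have fA : ∀ s ∈ Ioc 0 a, ‖f s‖ ≤ A * (t - s) ^ (-(α + 1)) := by
    intro s hs
    have hts : 0 < t - s := by have := hs.2; linarith
    rw [Real.norm_eq_abs, hf, abs_div, abs_of_nonneg (Real.rpow_nonneg hts.le (α+1)),
      Real.rpow_neg hts.le, div_eq_mul_inv]
    exact mul_le_mul_of_nonneg_right (bndA s hs) (by positivity)
  have fB : ∀ s ∈ Ioc a t, ‖f s‖ ≤ K * (t - s) ^ (-α) + M * (t - s) ^ (β - α - 1) := by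
    intro s hs
    rcases hs.2.eq_or_lt with h | h
    · have : f s = 0 := by rw [hf]; simp [h, Pt]
      rw [this, norm_zero, h, sub_self]
      positivity
    have hts : 0 < t - s := by linarith
    have q1 : (t - s) ^ (-α) = (t - s) / (t - s) ^ (α + 1) := by
      rw [Real.rpow_neg hts.le, Real.rpow_add_one hts.ne']; field_simp
    have q2 : (t - s) ^ (β - α - 1) = (t - s) ^ β / (t - s) ^ (α + 1) := by
      rw [← Real.rpow_sub hts]; ring_nf
    rw [q1, q2, Real.norm_eq_abs, hf, abs_div, abs_of_nonneg (Real.rpow_nonneg hts.le (α+1)),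
      ← mul_div_assoc, ← mul_div_assoc, ← add_div]
    exact div_le_div_of_nonneg_right (bndB s hs) (by positivity)
  have gB : ∀ s ∈ Ioc 0 t, ‖g s‖ ≤ M * (t - s) ^ (β - α - 1) := by
    intro s hs
    rcases hs.2.eq_or_lt with h | h
    · have : g s = 0 := by rw [hg]; simp [h]
      rw [this, norm_zero, h, sub_self]
      positivity
    have hts : 0 < t - s := by linarith
    have q2 : (t - s) ^ (β - α - 1) = (t - s) ^ β / (t - s) ^ (α + 1) := by
      rw [← Real.rpow_sub hts]; ring_nf
    rw [q2, Real.norm_eq_abs, hg, abs_div, abs_of_nonneg (Real.rpow_nonneg hts.le (α+1)),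
      ← mul_div_assoc]
    refine div_le_div_of_nonneg_right ?_ (by positivity)
    exact aux_holder hM0 hβ.le hM ⟨ht0.le, hnT⟩ ⟨hs.1.le, hs.2.trans hnT⟩
      (by rw [abs_of_pos hts])
  have iA : IntervalIntegrable (fun s => A * (t - s) ^ (-(α + 1))) volume 0 a :=
    (aux_int r1).const_mul A
  have iB1 : IntervalIntegrable (fun s => K * (t - s) ^ (-α)) volume a t :=
    (aux_int (Or.inl (by linarith))).const_mul K
  have iB2 : ∀ x, IntervalIntegrable (fun s => M * (t - s) ^ (β - α - 1)) volume x t :=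
    fun x => (aux_int (Or.inl (by linarith))).const_mul M
  have ifA : IntervalIntegrable f volume 0 a := by
    refine iA.mono_fun' ?_ ?_
    · rw [uIoc_of_le ha0.le]; exact fmeas _ _ le_rfl hat.le
    · rw [uIoc_of_le ha0.le]
      exact (ae_restrict_iff' measurableSet_Ioc).2 (Filter.Eventually.of_forall fA)
  have ifB : IntervalIntegrable f volume a t := by
    refine (iB1.add (iB2 a)).mono_fun' ?_ ?_
    · rw [uIoc_of_le hat.le]; exact fmeas _ _ ha0.le le_rfl
    · rw [uIoc_of_le hat.le]
      exact (ae_restrict_iff' measurableSet_Ioc).2 (Filter.Eventually.of_forall fB)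
  have ig : IntervalIntegrable g volume 0 t := by
    refine (iB2 0).mono_fun' ?_ ?_
    · rw [uIoc_of_le ht0.le]; exact gmeas _ _ le_rfl le_rfl
    · rw [uIoc_of_le ht0.le]
      exact (ae_restrict_iff' measurableSet_Ioc).2 (Filter.Eventually.of_forall gB)
  have hdiff : caputo α u t - L2approx α τ u (m + 1)
      = (α / Real.Gamma (1 - α)) * ((∫ s in (0:ℝ)..a, f s) + ∫ s in a..t, f s) := by
    have e1 : L2approx α τ u (m + 1) = caputo α P t := by
      unfold L2approx; push_cast; rfl
    have e2 : (∫ s in (0:ℝ)..t, (P t - P s) / (t - s) ^ (α + 1))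
        = (∫ s in (0:ℝ)..t, g s) - ∫ s in (0:ℝ)..t, f s := by
      rw [← intervalIntegral.integral_sub ig (ifA.trans ifB)]
      congr 1
      funext s
      simp only [hf, hg, Pt]
      ring
    rw [e1, intervalIntegral.integral_add_adjacent_intervals ifA ifB]
    unfold caputo
    rw [e2, Pt, P0]
    ring
  have nA : ‖∫ s in (0:ℝ)..a, f s‖ ≤ ∫ s in (0:ℝ)..a, A * (t - s) ^ (-(α + 1)) :=
    intervalIntegral.norm_integral_le_of_norm_le ha0.le (Filter.Eventually.of_forall fA) iA
  have nB : ‖∫ s in a..t, f s‖ ≤ ∫ s in a..t, (K * (t - s) ^ (-α) + M * (t - s) ^ (β - α - 1)) :=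
    intervalIntegral.norm_integral_le_of_norm_le hat.le (Filter.Eventually.of_forall fB)
      (iB1.add (iB2 a))
  have τsub : ∀ r : ℝ, τ ^ (β - r) = τ ^ β * τ ^ (-r) := fun r => by
    rw [sub_eq_add_neg, Real.rpow_add τ0]
  have vA : ∫ s in (0:ℝ)..a, A * (t - s) ^ (-(α + 1))
      = (2 ^ (β + 1) + 4) * (1 - ((m:ℝ) + 1) ^ (-α)) / α * M * τ ^ (β - α) := by
    rw [intervalIntegral.integral_const_mul, aux_val r1, hta, sub_zero, hA, ht,
      show -(α + 1) + 1 = -α by ring, Real.mul_rpow (by positivity) τ0.le, τsub]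
    field_simp
    ring
  have vB : ∫ s in a..t, (K * (t - s) ^ (-α) + M * (t - s) ^ (β - α - 1))
      = ((2 ^ (β - 1) + 2) / (1 - α) + 1 / (β - α)) * M * τ ^ (β - α) := by
    have h1 : 1 - α ≠ 0 := by linarith
    have h2 : β - α ≠ 0 := by linarith
    rw [intervalIntegral.integral_add iB1 (iB2 a), intervalIntegral.integral_const_mul,
      intervalIntegral.integral_const_mul, aux_val (Or.inl (by linarith)),
      aux_val (Or.inl (by linarith)), hta, sub_self, hK,
      show -α + 1 = 1 - α by ring, show β - α - 1 + 1 = β - α by ring,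
      Real.zero_rpow h1, Real.zero_rpow h2]
    have : τ ^ (β - α) = τ ^ (β - 1) * τ ^ (1 - α) := by
      rw [← Real.rpow_add τ0]; ring_nf
    rw [this]
    ring
  have G0 : 0 ≤ α / Real.Gamma (1 - α) :=
    div_nonneg hα0.le (Real.Gamma_pos_of_pos (by linarith)).le
  rw [hdiff, abs_mul, abs_of_nonneg G0, mul_assoc, mul_assoc]
  refine mul_le_mul_of_nonneg_left ?_ G0
  refine (abs_add_le _ _).trans ?_
  rw [Real.norm_eq_abs, vA] at nA
  rw [Real.norm_eq_abs, vB] at nB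
  linarith
end

section
/- Let T > 0, 0 < α < 1, 0 < β ≤ 1, and let u ∈ C^{2,β}([0,T]). Fix N ∈ ℕ, τ = T/N, t_j = jτ, and let n be an integer with 2 ≤ n ≤ N. Then the L2 scheme satisfies |D_t^α u(t_n) − δ_τ^α u(t_n)| ≤ (α/Γ(1−α)) · ( (2^{β+2}+4)(1 − n^{−α})/α + (2^{β+1}+2)/(1−α) ) · [u'']_{C^{0,β}[0,T]} · τ^{2+β−α}. -/
open Set MeasureTheory

lemma aux_rolle (a m b K : ℝ) (ham : a < m) (hmb : m < b) (e e' e'' : ℝ → ℝ)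
    (h1 : ∀ t ∈ Set.Icc a b, HasDerivWithinAt e (e' t) (Set.Icc a b) t)
    (h2 : ∀ t ∈ Set.Icc a b, HasDerivWithinAt e' (e'' t) (Set.Icc a b) t)
    (ha : e a = 0) (hm : e m = 0) (hb : e b = 0)
    (hK : ∀ x ∈ Set.Icc a b, ∀ y ∈ Set.Icc a b, |e'' x - e'' y| ≤ K)
    (s : ℝ) (hs : s ∈ Set.Icc a b) : |e s| ≤ K * (b - a) * (b - s) := by
  have c1 : ContinuousOn e (Set.Icc a b) := fun t ht => (h1 t ht).continuousWithinAt
  have c2 : ContinuousOn e' (Set.Icc a b) := fun t ht => (h2 t ht).continuousWithinAt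
  have d1 : ∀ t ∈ Set.Ioo a b, HasDerivAt e (e' t) t := fun t ht =>
    (h1 t ⟨ht.1.le, ht.2.le⟩).hasDerivAt (Icc_mem_nhds ht.1 ht.2)
  have d2 : ∀ t ∈ Set.Ioo a b, HasDerivAt e' (e'' t) t := fun t ht =>
    (h2 t ⟨ht.1.le, ht.2.le⟩).hasDerivAt (Icc_mem_nhds ht.1 ht.2)
  obtain ⟨x, hx, hx0⟩ := exists_hasDerivAt_eq_zero ham
    (c1.mono (Set.Icc_subset_Icc le_rfl hmb.le)) (ha.trans hm.symm)
    (fun t ht => d1 t ⟨ht.1, ht.2.trans hmb⟩)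
  obtain ⟨y, hy, hy0⟩ := exists_hasDerivAt_eq_zero hmb
    (c1.mono (Set.Icc_subset_Icc ham.le le_rfl)) (hm.trans hb.symm)
    (fun t ht => d1 t ⟨ham.trans ht.1, ht.2⟩)
  have hxI : x ∈ Set.Icc a b := ⟨hx.1.le, (hx.2.trans hmb).le⟩
  obtain ⟨z, hz, hz0⟩ := exists_hasDerivAt_eq_zero (hx.2.trans hy.1)
    (c2.mono (Set.Icc_subset_Icc hx.1.le hy.2.le)) (hx0.trans hy0.symm)
    (fun t ht => d2 t ⟨hx.1.trans ht.1, ht.2.trans hy.2⟩)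
  have hzI : z ∈ Set.Icc a b := ⟨(hx.1.trans hz.1).le, (hz.2.trans hy.2).le⟩
  have hK0 : 0 ≤ K := (abs_nonneg _).trans (hK z hzI z hzI)
  have b2 : ∀ t ∈ Set.Icc a b, ‖e'' t‖ ≤ K := fun t ht => by
    have := hK t ht z hzI
    rwa [hz0, sub_zero] at this
  have b1 : ∀ t ∈ Set.Icc a b, ‖e' t‖ ≤ K * (b - a) := fun t ht => by
    have := (convex_Icc a b).norm_image_sub_le_of_norm_hasDerivWithin_le h2 b2 hxI ht
    rw [hx0, sub_zero] at this
    refine this.trans (mul_le_mul_of_nonneg_left ?_ hK0)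
    rw [Real.norm_eq_abs, abs_le]
    constructor <;> linarith [ht.1, ht.2, hxI.1, hxI.2]
  have := (convex_Icc a b).norm_image_sub_le_of_norm_hasDerivWithin_le h1 b1
    (show b ∈ Set.Icc a b from ⟨(ham.trans hmb).le, le_rfl⟩) hs
  rw [hb, sub_zero, Real.norm_eq_abs, Real.norm_eq_abs, abs_sub_comm, abs_of_nonneg (by linarith [hs.2] : 0 ≤ b - s)] at this
  exact this

lemma aux_interp (T β M : ℝ) (hβ0 : 0 < β) (u u' u'' : ℝ → ℝ)
    (hderiv : ∀ t ∈ Set.Icc (0:ℝ) T, HasDerivWithinAt u (u' t) (Set.Icc 0 T) t)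
    (hderiv2 : ∀ t ∈ Set.Icc (0:ℝ) T, HasDerivWithinAt u' (u'' t) (Set.Icc 0 T) t)
    (hM0 : 0 ≤ M) (hM : holderBnd T β M u'') (τ : ℝ) (hτ : 0 < τ) (j : ℕ) (hj : 1 ≤ j)
    (hjT : ((j:ℝ)+1)*τ ≤ T) (s : ℝ) (hs : s ∈ Set.Icc (((j:ℝ)-1)*τ) (((j:ℝ)+1)*τ)) :
    |Pi2 τ u j s - u s| ≤ 2 ^ (β + 1) * M * τ ^ (1 + β) * (((j:ℝ)+1)*τ - s) := by
  have hj1 : (1:ℝ) ≤ j := by exact_mod_cast hj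
  have hsub : Set.Icc (((j:ℝ)-1)*τ) (((j:ℝ)+1)*τ) ⊆ Set.Icc 0 T :=
    Set.Icc_subset_Icc (mul_nonneg (by linarith) hτ.le) hjT
  obtain ⟨c0, c1, c2, hc⟩ : ∃ c0 c1 c2 : ℝ, ∀ x, Pi2 τ u j x = c0 + c1 * x + c2 * x ^ 2 := by
    set A := u (((j:ℝ)-1)*τ) / (2*τ^2)
    set B := u ((j:ℝ)*τ) / τ^2
    set C := u (((j:ℝ)+1)*τ) / (2*τ^2)
    refine ⟨(j*τ)*((j+1)*τ)*A - ((j-1)*τ)*((j+1)*τ)*B + ((j-1)*τ)*(j*τ)*C,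
      -(j*τ + (j+1)*τ)*A + ((j-1)*τ+(j+1)*τ)*B - ((j-1)*τ+j*τ)*C, A - B + C, fun x => ?_⟩
    simp only [Pi2, A, B, C]
    ring
  have := aux_rolle (((j:ℝ)-1)*τ) (j*τ) (((j:ℝ)+1)*τ) (M * (2*τ)^β) (by linarith) (by linarith)
    (fun x => Pi2 τ u j x - u x) (fun x => c1 + c2 * (2 * x) - u' x) (fun x => c2 * 2 - u'' x)
    (fun t ht => by
      simp only [hc]
      refine HasDerivWithinAt.sub ?_ ((hderiv t (hsub ht)).mono hsub)
      have h := (((hasDerivAt_id t).const_mul c1).const_add c0).add (((hasDerivAt_id t).pow 2).const_mul c2)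
      have e : c1 + c2 * (2 * t) = c1 * 1 + c2 * (((2:ℕ):ℝ) * id t ^ (2 - 1) * 1) := by simp
      rw [e]
      exact h.hasDerivWithinAt)
    (fun t ht => by
      refine HasDerivWithinAt.sub ?_ ((hderiv2 t (hsub ht)).mono hsub)
      have h := (((hasDerivAt_id t).const_mul 2).const_mul c2).const_add c1
      have e : c2 * 2 = c2 * (2 * 1) := by ring
      rw [e]
      exact h.hasDerivWithinAt)
    (by simp only [Pi2]; field_simp; ring)
    (by simp only [Pi2]; field_simp; ring)
    (by simp only [Pi2]; field_simp; ring)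
    (fun x hx y hy => by
      have h := hM y (hsub hy) x (hsub hx)
      have e : c2 * 2 - u'' x - (c2 * 2 - u'' y) = u'' y - u'' x := by ring
      rw [e]
      refine h.trans (mul_le_mul_of_nonneg_left ?_ hM0)
      refine Real.rpow_le_rpow (abs_nonneg _) ?_ hβ0.le
      rw [abs_le]
      constructor <;> linarith [hx.1, hx.2, hy.1, hy.2])
    s hs
  refine this.trans (le_of_eq ?_)
  rw [Real.mul_rpow (by norm_num) hτ.le, Real.rpow_add_one (by norm_num), Real.rpow_add hτ,
    Real.rpow_one]
  ring

lemma aux_rpow (t α : ℝ) (s : ℝ) (hs : s < t) (x C : ℝ) (hx : |x| ≤ C * (t - s)) :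
    ‖x / (t - s) ^ (α + 1)‖ ≤ C * (t - s) ^ (-α) := by
  have h : 0 < t - s := by linarith
  rw [Real.norm_eq_abs, abs_div, abs_of_pos (Real.rpow_pos_of_pos h _),
    div_le_iff₀ (Real.rpow_pos_of_pos h _), mul_assoc, ← Real.rpow_add h]
  simpa using hx

lemma aux_rpow2 (t α : ℝ) (s : ℝ) (hs : s < t) (x C : ℝ) (hx : |x| ≤ C) :
    ‖x / (t - s) ^ (α + 1)‖ ≤ C * (t - s) ^ (-α - 1) := by
  have h : 0 < t - s := by linarith
  rw [Real.norm_eq_abs, abs_div, abs_of_pos (Real.rpow_pos_of_pos h _),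
    div_le_iff₀ (Real.rpow_pos_of_pos h _), mul_assoc, ← Real.rpow_add h]
  simpa using hx

theorem stmt8 (T : ℝ) (hT : 0 < T) (α β : ℝ) (hα0 : 0 < α) (hα1 : α < 1)
    (hβ0 : 0 < β) (hβ1 : β ≤ 1)
    (u u' u'' : ℝ → ℝ)
    (hderiv : ∀ t ∈ Set.Icc (0:ℝ) T, HasDerivWithinAt u (u' t) (Set.Icc 0 T) t)
    (hderiv2 : ∀ t ∈ Set.Icc (0:ℝ) T, HasDerivWithinAt u' (u'' t) (Set.Icc 0 T) t)
    (hu'' : ContinuousOn u'' (Set.Icc 0 T))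
    (M : ℝ) (hM0 : 0 ≤ M) (hM : holderBnd T β M u'')
    (N : ℕ) (hN : 0 < N) (τ : ℝ) (hτ : τ = T / N)
    (n : ℕ) (hn : 2 ≤ n) (hnN : n ≤ N) :
    |caputo α u ((n:ℝ)*τ) - L2approx α τ u n| ≤
      (α / Real.Gamma (1 - α)) *
        ((2 ^ (β + 2) + 4) * (1 - (n:ℝ) ^ (-α)) / α
          + (2 ^ (β + 1) + 2) / (1 - α)) * M * τ ^ (2 + β - α) := by
  have hN' : (0:ℝ) < N := by exact_mod_cast hN
  have hτ0 : 0 < τ := by rw [hτ]; positivity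
  have hn2 : (2:ℝ) ≤ n := by exact_mod_cast hn
  have hnT : (n:ℝ) * τ ≤ T := by
    have : (n:ℝ) ≤ N := by exact_mod_cast hnN
    calc (n:ℝ) * τ ≤ N * τ := by gcongr
      _ = T := by rw [hτ]; field_simp
  have hcast : ((n-1 : ℕ) : ℝ) = (n:ℝ) - 1 := by
    rw [Nat.cast_sub (by omega)]; simp
  set t := (n:ℝ) * τ with ht
  have htτ : 2 * τ ≤ t := by rw [ht]; gcongr
  set P := L2interp τ u n with hP
  have hPt : P t = u t := by
    have h1 : ((n:ℝ)-1)*τ < t := by rw [ht]; linarith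
    simp only [hP, L2interp, if_pos h1, Pi2, hcast]
    have h2 : ((n:ℝ) - 1 + 1) = n := by ring
    rw [h2, ← ht]
    have h3 : (t - ((n:ℝ) - 1 - 1) * τ) * (t - ((n:ℝ) - 1) * τ) = 2 * τ^2 := by rw [ht]; ring
    rw [h3]
    field_simp
    ring
  have hP0 : P 0 = u 0 := by
    have h1 : ¬ ((n:ℝ)-1)*τ < 0 := not_lt.2 (mul_nonneg (by linarith) hτ0.le)
    simp only [hP, L2interp, if_neg h1, Pi2]
    simp
    field_simp
  set K := 2 ^ (β + 1) * M * τ ^ (1 + β) with hKdef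
  have hK0 : 0 ≤ K := by positivity
  -- error bounds
  have hE1 : ∀ s ∈ Set.Ioc 0 (t - τ), |P s - u s| ≤ K * (2 * τ) := by
    intro s hs
    have h1 : ¬ ((n:ℝ)-1)*τ < s := not_lt.2 (by have := hs.2; rw [ht] at this; linarith)
    simp only [hP, L2interp, if_neg h1]
    set j := ⌈s/τ⌉₊ with hj
    have hsτ : 0 < s / τ := div_pos hs.1 hτ0
    have hj1 : 1 ≤ j := Nat.one_le_ceil_iff.2 hsτ
    have hjn : j ≤ n - 1 := by
      rw [hj, Nat.ceil_le, hcast, div_le_iff₀ hτ0]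
      exact not_lt.1 h1
    have hjn' : (j:ℝ) ≤ n - 1 := by rw [← hcast]; exact_mod_cast hjn
    have a1 : s ≤ j * τ := (div_le_iff₀ hτ0).1 (Nat.le_ceil _)
    have a2 : ((j:ℝ) - 1) * τ < s := by
      rw [← lt_div_iff₀ hτ0]; linarith [Nat.ceil_lt_add_one hsτ.le]
    have a3 : ((j:ℝ)+1)*τ ≤ t := by
      rw [ht]; exact mul_le_mul_of_nonneg_right (by linarith) hτ0.le
    refine (aux_interp T β M hβ0 u u' u'' hderiv hderiv2 hM0 hM τ hτ0 j hj1 (a3.trans hnT) s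
      ⟨a2.le, by linarith⟩).trans ?_
    exact mul_le_mul_of_nonneg_left (by linarith) hK0
  have hE2 : ∀ s ∈ Set.Ioc (t - τ) t, |P s - u s| ≤ K * (t - s) := by
    intro s hs
    have h1 : ((n:ℝ)-1)*τ < s := by have := hs.1; rw [ht] at this; linarith
    simp only [hP, L2interp, if_pos h1]
    have e1 : (((n-1:ℕ):ℝ)+1)*τ = t := by rw [hcast, ht]; ring
    have e2 : (((n-1:ℕ):ℝ)-1)*τ = t - 2 * τ := by rw [hcast, ht]; ring
    have := aux_interp T β M hβ0 u u' u'' hderiv hderiv2 hM0 hM τ hτ0 (n-1) (by omega)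
      (by rw [e1]; exact hnT) s (by rw [e1, e2]; exact ⟨by linarith [hs.1], hs.2⟩)
    rwa [e1] at this
  have hucont : ContinuousOn u (Set.Icc 0 T) := fun x hx => (hderiv x hx).continuousWithinAt
  have hu'cont : ContinuousOn u' (Set.Icc 0 T) := fun x hx => (hderiv2 x hx).continuousWithinAt
  have ht0 : 0 < t := by linarith
  have hsubT : Set.Ioc 0 t ⊆ Set.Icc 0 T := fun x hx => ⟨hx.1.le, hx.2.trans hnT⟩
  have hum : AEStronglyMeasurable u (volume.restrict (Set.Ioc 0 t)) :=
    (hucont.mono hsubT).aestronglyMeasurable measurableSet_Ioc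
  have hden : Measurable (fun s : ℝ => (t - s) ^ (α + 1)) := by fun_prop
  -- weights
  have hw : ∀ a b, IntervalIntegrable (fun s : ℝ => (t - s) ^ (-α)) volume a b := fun a b => by
    have := (intervalIntegral.intervalIntegrable_rpow' (a := t - a) (b := t - b)
      (r := -α) (by linarith)).comp_sub_left t
    simpa using this
  have hw2 : IntervalIntegrable (fun s : ℝ => (t - s) ^ (-α - 1)) volume 0 (t - τ) := by
    have := (intervalIntegral.intervalIntegrable_rpow (μ := volume) (a := t) (b := τ) (r := -α - 1)
      (Or.inr (by rw [Set.uIcc_of_ge (by linarith)]; intro h; linarith [h.1]))).comp_sub_left t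
    simpa using this
  -- F integrable
  have hF : IntervalIntegrable (fun s => (u t - u s) / (t - s) ^ (α + 1)) volume 0 t := by
    obtain ⟨L, hL⟩ := isCompact_Icc.exists_bound_of_continuousOn hu'cont
    refine ((hw 0 t).const_mul L).mono_fun' ?_ ?_
    · rw [Set.uIoc_of_le ht0.le]
      exact (aestronglyMeasurable_const.sub hum).div₀ hden.aestronglyMeasurable
    · rw [Set.uIoc_of_le ht0.le]
      refine (ae_restrict_iff' measurableSet_Ioc).2 (Filter.Eventually.of_forall fun s hs => ?_)
      rcases hs.2.eq_or_lt with h | h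
      · subst h
        simp [Real.zero_rpow (by linarith : α + 1 ≠ 0), Real.zero_rpow (by linarith : -α ≠ 0)]
      · refine aux_rpow t α s h _ L ?_
        have := (convex_Icc 0 T).norm_image_sub_le_of_norm_hasDerivWithin_le hderiv hL
          (hsubT hs) (⟨ht0.le, hnT⟩ : t ∈ Set.Icc 0 T)
        rwa [Real.norm_eq_abs, Real.norm_eq_abs, abs_of_nonneg (by linarith : 0 ≤ t - s)] at this
  set E := fun s => (P s - u s) / (t - s) ^ (α + 1) with hEdef
  have hEm : AEStronglyMeasurable E (volume.restrict (Set.Ioc 0 t)) :=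
    ((aux_meas τ u n).aestronglyMeasurable.sub hum).div₀ hden.aestronglyMeasurable
  have bE1 : ∀ s ∈ Set.Ioc 0 (t - τ), ‖E s‖ ≤ K * (2 * τ) * (t - s) ^ (-α - 1) := fun s hs =>
    aux_rpow2 t α s (by linarith [hs.2]) _ _ (hE1 s hs)
  have bE2 : ∀ s ∈ Set.Ioc (t - τ) t, ‖E s‖ ≤ K * (t - s) ^ (-α) := fun s hs => by
    rcases hs.2.eq_or_lt with h | h
    · simp only [hEdef, h]
      simp [Real.zero_rpow (by linarith : α + 1 ≠ 0), Real.zero_rpow (by linarith : -α ≠ 0)]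
    · exact aux_rpow t α s h _ _ (hE2 s hs)
  have iE1 : IntervalIntegrable E volume 0 (t - τ) := by
    refine (hw2.const_mul (K * (2 * τ))).mono_fun' ?_ ?_
    · rw [Set.uIoc_of_le (by linarith)]
      exact hEm.mono_measure (Measure.restrict_mono (Set.Ioc_subset_Ioc le_rfl (by linarith)) le_rfl)
    · rw [Set.uIoc_of_le (by linarith)]
      exact (ae_restrict_iff' measurableSet_Ioc).2 (Filter.Eventually.of_forall bE1)
  have iE2 : IntervalIntegrable E volume (t - τ) t := by
    refine ((hw _ _).const_mul K).mono_fun' ?_ ?_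
    · rw [Set.uIoc_of_le (by linarith)]
      exact hEm.mono_measure (Measure.restrict_mono (Set.Ioc_subset_Ioc (by linarith) le_rfl) le_rfl)
    · rw [Set.uIoc_of_le (by linarith)]
      exact (ae_restrict_iff' measurableSet_Ioc).2 (Filter.Eventually.of_forall bE2)
  have v1 : ∫ s in (0:ℝ)..(t - τ), (t - s) ^ (-α - 1) = τ ^ (-α) * ((1 - (n:ℝ) ^ (-α)) / α) := by
    rw [intervalIntegral.integral_comp_sub_left (fun x : ℝ => x ^ (-α - 1)) t,
      integral_rpow (Or.inr ⟨by linarith, by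
        rw [Set.uIcc_of_le (by linarith)]; intro h; linarith [h.1]⟩)]
    have e1 : t - (t - τ) = τ := by ring
    have e2 : -α - 1 + 1 = -α := by ring
    rw [e1, e2, sub_zero, ht, Real.mul_rpow (by linarith) hτ0.le]
    field_simp
    ring
  have v2 : ∫ s in (t - τ)..t, (t - s) ^ (-α) = τ ^ (1 - α) / (1 - α) := by
    rw [intervalIntegral.integral_comp_sub_left (fun x : ℝ => x ^ (-α)) t,
      integral_rpow (Or.inl (by linarith))]
    have e1 : t - (t - τ) = τ := by ring
    have e2 : -α + 1 = 1 - α := by ring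
    rw [e1, e2, sub_self, Real.zero_rpow (by linarith), sub_zero]
  have B1 : ‖∫ s in (0:ℝ)..(t - τ), E s‖ ≤ K * (2 * τ) * (τ ^ (-α) * ((1 - (n:ℝ) ^ (-α)) / α)) := by
    rw [← v1, ← intervalIntegral.integral_const_mul]
    exact intervalIntegral.norm_integral_le_of_norm_le (by linarith)
      (Filter.Eventually.of_forall bE1) (hw2.const_mul _)
  have B2 : ‖∫ s in (t - τ)..t, E s‖ ≤ K * (τ ^ (1 - α) / (1 - α)) := by
    rw [← v2, ← intervalIntegral.integral_const_mul]
    exact intervalIntegral.norm_integral_le_of_norm_le (by linarith)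
      (Filter.Eventually.of_forall bE2) ((hw _ _).const_mul _)
  have hG : ∫ s in (0:ℝ)..t, (P t - P s) / (t - s) ^ (α + 1) =
      (∫ s in (0:ℝ)..t, (u t - u s) / (t - s) ^ (α + 1)) - ∫ s in (0:ℝ)..t, E s := by
    rw [← intervalIntegral.integral_sub hF (iE1.trans iE2)]
    congr 1
    funext s
    rw [hPt, hEdef]
    ring
  have hΓ : 0 < Real.Gamma (1 - α) := Real.Gamma_pos_of_pos (by linarith)
  have hdiff : caputo α u t - L2approx α τ u n =
      (α / Real.Gamma (1 - α)) * ∫ s in (0:ℝ)..t, E s := by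
    unfold L2approx caputo
    rw [← ht, ← hP, hG, hPt, hP0]
    ring
  rw [hdiff, abs_mul, abs_of_pos (div_pos hα0 hΓ), mul_assoc, mul_assoc]
  refine mul_le_mul_of_nonneg_left ?_ (div_pos hα0 hΓ).le
  rw [← intervalIntegral.integral_add_adjacent_intervals iE1 iE2]
  refine (norm_add_le _ _).trans ((add_le_add B1 B2).trans ?_)
  have p1 : τ ^ (1 + β) * (τ * τ ^ (-α)) = τ ^ (2 + β - α) := by
    nth_rewrite 2 [← Real.rpow_one τ]
    rw [← Real.rpow_add hτ0, ← Real.rpow_add hτ0]; congr 1; ring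
  have p2 : τ ^ (1 + β) * τ ^ (1 - α) = τ ^ (2 + β - α) := by
    rw [← Real.rpow_add hτ0]; congr 1; ring
  have p3 : (2:ℝ) ^ (β + 2) = 2 ^ (β + 1) * 2 := by
    rw [← Real.rpow_add_one (by norm_num)]; congr 1; ring
  have hq1 : 0 ≤ (1 - (n:ℝ) ^ (-α)) / α := by
    refine div_nonneg (sub_nonneg.2 ?_) hα0.le
    exact Real.rpow_le_one_of_one_le_of_nonpos (by linarith) (by linarith)
  have hq2 : 0 ≤ 1 / (1 - α) := by
    have : 0 < 1 - α := by linarith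
    positivity
  have hZ : 0 ≤ M * τ ^ (2 + β - α) := by positivity
  have l1 : K * (2 * τ) * (τ ^ (-α) * ((1 - (n:ℝ) ^ (-α)) / α)) =
      2 ^ (β + 1) * 2 * ((1 - (n:ℝ) ^ (-α)) / α) * (M * τ ^ (2 + β - α)) := by
    rw [← p1, hKdef]; ring
  have l2 : K * (τ ^ (1 - α) / (1 - α)) = 2 ^ (β + 1) * (1 / (1 - α)) * (M * τ ^ (2 + β - α)) := by
    rw [← p2, hKdef]; ring
  rw [l1, l2, p3, ← add_mul]
  refine mul_le_mul_of_nonneg_right ?_ hZ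
  have : (2 ^ (β + 1) * 2 + 4) * (1 - (n:ℝ) ^ (-α)) / α + (2 ^ (β + 1) + 2) / (1 - α) =
    2 ^ (β + 1) * 2 * ((1 - (n:ℝ) ^ (-α)) / α) + 2 ^ (β + 1) * (1 / (1 - α)) +
      (4 * ((1 - (n:ℝ) ^ (-α)) / α) + 2 * (1 / (1 - α))) := by ring
  rw [this]
  linarith
end
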